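/- Let f : ℝ² → ℝ² be a smooth immersion of a neighborhood of S¹ × {0} ⊂ S¹ × ℝ into ℝ² (not necessarily injective), where S¹ × ℝ carries the area form ds ∧ dt and ℝ² the form dx ∧ dy. Suppose f*(dx ∧ dy) is a positive multiple ρ(s,t) ds ∧ dt of ds ∧ dt with ρ smooth and positive. Then there exist δ > 0 and a smooth diffeomorphism θ : S¹ × (-δ, δ) → θ(S¹ × (-δ,δ)) ⊆ S¹ × ℝ with θ(s,0) = (s,0) for all s, such that (f ∘ θ)*(dx ∧ dy) = ds ∧ dt on S¹ × (-δ, δ). -/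

import Mathlib

open Set Real

/-- Smoothness of an integral over `[0,1]` depending on a parameter. -/
theorem moser_contDiff_integral_nat (n : ℕ) : ∀ {F : Type} [NormedAddCommGroup F] [NormedSpace ℝ F]
    (g : (ℝ × ℝ) → ℝ → F),
    ContDiff ℝ n (fun q : (ℝ × ℝ) × ℝ => g q.1 q.2) →
    ContDiff ℝ n (fun x => ∫ u in (0:ℝ)..1, g x u) := by
  induction n with
  | zero =>
    intro F _ _ g hg
    rw [Nat.cast_zero, contDiff_zero] at hg ⊢
    exact intervalIntegral.continuous_parametric_intervalIntegral_of_continuous' hg 0 1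
  | succ n ih =>
    intro F _ _ g hg
    have hgc : Continuous (fun q : (ℝ × ℝ) × ℝ => g q.1 q.2) := hg.continuous
    let G : (ℝ × ℝ) → ℝ → ((ℝ × ℝ) →L[ℝ] F) := fun x u =>
      (fderiv ℝ (fun q : (ℝ × ℝ) × ℝ => g q.1 q.2) (x, u)).comp
        (ContinuousLinearMap.inl ℝ (ℝ × ℝ) ℝ)
    have hG : ContDiff ℝ n (fun q : (ℝ × ℝ) × ℝ => G q.1 q.2) := by
      have h1 : ContDiff ℝ n (fderiv ℝ (fun q : (ℝ × ℝ) × ℝ => g q.1 q.2)) :=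
        hg.fderiv_right (by norm_cast)
      exact h1.clm_comp contDiff_const
    have hGc : Continuous (fun q : (ℝ × ℝ) × ℝ => G q.1 q.2) := hG.continuous
    have hder : ∀ x u, HasFDerivAt (fun y => g y u) (G x u) x := by
      intro x u
      have h1 : HasFDerivAt (fun q : (ℝ × ℝ) × ℝ => g q.1 q.2) _ (x, u) :=
        (hg.differentiable (by norm_cast) (x, u)).hasFDerivAt
      exact HasFDerivAt.comp (f := fun e : ℝ × ℝ => (e, u)) x h1 (hasFDerivAt_prodMk_left x u)
    have hint : ∀ x, HasFDerivAt (fun x => ∫ u in (0:ℝ)..1, g x u) (∫ u in (0:ℝ)..1, G x u) x := by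
      intro x
      obtain ⟨C, hC⟩ := ((isCompact_closedBall x 1).prod (isCompact_Icc (a := (0:ℝ)) (b := 1))).exists_bound_of_continuousOn
        hGc.continuousOn
      refine (intervalIntegral.hasFDerivAt_integral_of_dominated_of_fderiv_le (bound := fun _ => C)
        (s := Metric.ball x 1) (F' := G) (Metric.ball_mem_nhds x one_pos) ?_ ?_ ?_ ?_ ?_ ?_)
      · refine Filter.Eventually.of_forall fun y => ?_
        exact (hgc.comp (by fun_prop : Continuous fun u : ℝ => (y, u))).aestronglyMeasurable
      · exact (hgc.comp (by fun_prop : Continuous fun u : ℝ => (x, u))).intervalIntegrable _ _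
      · exact (hGc.comp (by fun_prop : Continuous fun u : ℝ => (x, u))).aestronglyMeasurable
      · refine Filter.Eventually.of_forall fun u hu y hy => ?_
        rw [uIoc_of_le zero_le_one] at hu
        exact hC (y, u) ⟨Metric.ball_subset_closedBall hy, Ioc_subset_Icc_self hu⟩
      · exact intervalIntegrable_const
      · exact Filter.Eventually.of_forall fun u _ y _ => hder y u
    push_cast
    rw [contDiff_succ_iff_fderiv]
    refine ⟨fun x => (hint x).differentiableAt, by simp, ?_⟩
    have : fderiv ℝ (fun x => ∫ u in (0:ℝ)..1, g x u) = fun x => ∫ u in (0:ℝ)..1, G x u :=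
      funext fun x => (hint x).fderiv
    rw [this]
    exact ih G hG

theorem moser_contDiff_primitive (g : ℝ × ℝ → ℝ) (hg : ContDiff ℝ (⊤ : ℕ∞) g) :
    ContDiff ℝ (⊤ : ℕ∞) (fun p : ℝ × ℝ => ∫ u in (0:ℝ)..p.2, g (p.1, u)) := by
  have h : (fun p : ℝ × ℝ => ∫ u in (0:ℝ)..p.2, g (p.1, u)) =
      fun p : ℝ × ℝ => p.2 * ∫ u in (0:ℝ)..1, g (p.1, p.2 * u) := by
    funext p
    have := intervalIntegral.mul_integral_comp_mul_left (a := 0) (b := 1)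
      (f := fun u => g (p.1, u)) (c := p.2)
    simpa using this.symm
  rw [h]
  refine contDiff_snd.mul ?_
  rw [contDiff_infty]
  intro n
  apply moser_contDiff_integral_nat n (fun p u => g (p.1, p.2 * u))
  have : ContDiff ℝ n g := hg.of_le (by exact_mod_cast le_top)
  exact this.comp (by fun_prop)

theorem moser_det (A : (ℝ × ℝ) →L[ℝ] ℝ) :
    ((ContinuousLinearMap.fst ℝ ℝ ℝ).prod A).det = A (0, 1) := by
  rw [ContinuousLinearMap.det, ← LinearMap.det_toMatrix (Module.Basis.finTwoProd ℝ),
    Matrix.det_fin_two]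
  simp [LinearMap.toMatrix_apply]

/-- Global fibrewise construction for a positive density equal to one far away. -/
theorem moser_global (g : ℝ × ℝ → ℝ) (ε : ℝ) (hε : 0 < ε)
    (hg : ContDiff ℝ (⊤ : ℕ∞) g) (hpos : ∀ p, 0 < g p)
    (hper : ∀ s t, g (s + 2 * π, t) = g (s, t))
    (hone : ∀ p : ℝ × ℝ, ε ≤ |p.2| → g p = 1) (η : ℝ) (hη : 0 < η) :
    ∃ δ > 0, ∃ θ : (ℝ × ℝ) → (ℝ × ℝ),
      ContDiff ℝ (⊤ : ℕ∞) θ ∧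
      (∀ s t, θ (s + 2 * π, t) = ((θ (s, t)).1 + 2 * π, (θ (s, t)).2)) ∧
      Function.Injective θ ∧
      (∀ p, g (θ p) * (fderiv ℝ θ p).det = 1) ∧
      (∀ p : ℝ × ℝ, |p.2| < δ → |(θ p).2| < η) ∧
      (∀ s, θ (s, 0) = (s, 0)) := by
  set F : ℝ × ℝ → ℝ := fun p => ∫ u in (0:ℝ)..p.2, g (p.1, u) with hFdef
  have hF : ContDiff ℝ (⊤ : ℕ∞) F := moser_contDiff_primitive g hg
  have hFd : Differentiable ℝ F := hF.differentiable (by simp)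
  have hgs : ∀ s, Continuous fun u => g (s, u) := fun s => hg.continuous.comp (by fun_prop)
  have hFt : ∀ s t, HasDerivAt (fun t => F (s, t)) (g (s, t)) t := fun s t =>
    intervalIntegral.integral_hasDerivAt_right ((hgs s).intervalIntegrable _ _)
      ((hgs s).stronglyMeasurableAtFilter _ _) (hgs s).continuousAt
  have hF01 : ∀ p, fderiv ℝ F p (0, 1) = g p := by
    rintro ⟨s, t⟩
    have h1 := (hFd (s, t)).hasFDerivAt.comp_hasDerivAt t
      ((hasDerivAt_const t s).prodMk (hasDerivAt_id t))
    exact h1.unique (hFt s t)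
  have hmono : ∀ s, StrictMono fun t => F (s, t) := fun s =>
    strictMono_of_hasDerivAt_pos (hFt s) (fun t => hpos (s, t))
  have hF0 : ∀ s, F (s, 0) = 0 := fun s => by simp [hFdef]
  have hFper : ∀ s t, F (s + 2 * π, t) = F (s, t) := fun s t => by simp [hFdef, hper]
  have hup : ∀ s y, 0 ≤ y → y ≤ F (s, ε + y) := by
    intro s y hy
    have h1 : F (s, ε) + ∫ u in ε..(ε + y), g (s, u) = F (s, ε + y) :=
      intervalIntegral.integral_add_adjacent_intervals
        ((hgs s).intervalIntegrable _ _) ((hgs s).intervalIntegrable _ _)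
    have h2 : ∫ u in ε..(ε + y), g (s, u) = ∫ u in ε..(ε + y), (1:ℝ) := by
      apply intervalIntegral.integral_congr
      intro u hu
      rw [uIcc_of_le (by linarith)] at hu
      exact hone (s, u) (hu.1.trans (le_abs_self _))
    have h3 : F (s, 0) < F (s, ε) := hmono s hε
    rw [h2] at h1
    simp at h1
    rw [hF0] at h3
    linarith
  have hdown : ∀ s y, 0 ≤ y → F (s, -(ε + y)) ≤ -y := by
    intro s y hy
    have h1 : F (s, -ε) + ∫ u in (-ε)..(-(ε + y)), g (s, u) = F (s, -(ε + y)) :=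
      intervalIntegral.integral_add_adjacent_intervals
        ((hgs s).intervalIntegrable _ _) ((hgs s).intervalIntegrable _ _)
    have h2 : ∫ u in (-ε)..(-(ε + y)), g (s, u) = ∫ u in (-ε)..(-(ε + y)), (1:ℝ) := by
      apply intervalIntegral.integral_congr
      intro u hu
      rw [uIcc_of_ge (by linarith)] at hu
      refine hone (s, u) ?_
      have := neg_le_abs u
      have := hu.2
      simp only
      linarith
    have h3 : F (s, -ε) < F (s, 0) := hmono s (by linarith)
    rw [h2] at h1
    rw [intervalIntegral.integral_const, smul_eq_mul] at h1
    rw [hF0] at h3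
    linarith
  have hsurj : ∀ s y, ∃ t, F (s, t) = y := by
    intro s y
    have hc : Continuous fun t => F (s, t) := hF.continuous.comp (by fun_prop)
    have h1 := hup s |y| (abs_nonneg y)
    have h2 := hdown s |y| (abs_nonneg y)
    exact mem_range_of_exists_le_of_exists_ge hc ⟨_, h2.trans (neg_abs_le y)⟩
      ⟨_, (le_abs_self y).trans h1⟩
  let Φ : ℝ × ℝ → ℝ × ℝ := fun p => (p.1, F p)
  have hΦ : ContDiff ℝ (⊤ : ℕ∞) Φ := contDiff_fst.prodMk hF
  have hΦb : Function.Bijective Φ := by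
    constructor
    · rintro ⟨s, t⟩ ⟨s', t'⟩ h
      obtain ⟨h1, h2⟩ := Prod.mk.inj h
      simp only at h1
      subst h1
      rw [(hmono s).injective h2]
    · rintro ⟨s, y⟩
      obtain ⟨t, ht⟩ := hsurj s y
      exact ⟨(s, t), by simp [Φ, ht]⟩
  have hΦd : ∀ p, HasFDerivAt Φ ((ContinuousLinearMap.fst ℝ ℝ ℝ).prod (fderiv ℝ F p)) p :=
    fun p => hasFDerivAt_fst.prodMk (hFd p).hasFDerivAt
  have hdet : ∀ p, ((ContinuousLinearMap.fst ℝ ℝ ℝ).prod (fderiv ℝ F p)).det = g p := fun p => by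
    rw [moser_det, hF01]
  let D : ℝ × ℝ → ((ℝ × ℝ) ≃L[ℝ] (ℝ × ℝ)) := fun p =>
    ContinuousLinearMap.toContinuousLinearEquivOfDetNeZero
      ((ContinuousLinearMap.fst ℝ ℝ ℝ).prod (fderiv ℝ F p)) (by rw [hdet]; exact (hpos p).ne')
  have hD : ∀ p, HasFDerivAt Φ (D p : (ℝ × ℝ) →L[ℝ] (ℝ × ℝ)) p := fun p => hΦd p
  have hopen : IsOpenMap Φ := isOpenMap_of_hasStrictFDerivAt_equiv (f' := D) fun p =>
    hΦ.contDiffAt.hasStrictFDerivAt' (hD p) (by simp)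
  let H : (ℝ × ℝ) ≃ₜ (ℝ × ℝ) :=
    (Equiv.ofBijective Φ hΦb).toHomeomorphOfContinuousOpen hΦ.continuous hopen
  have hHΦ : ∀ p, Φ (H.symm p) = p := fun p => H.apply_symm_apply p
  have hHsymm : ContDiff ℝ (⊤ : ℕ∞) H.symm := H.contDiff_symm (f₀' := D) hD hΦ
  have hfst : ∀ p, (H.symm p).1 = p.1 := fun p => by
    have := congrArg Prod.fst (hHΦ p)
    exact this
  have hsnd : ∀ p, F (H.symm p) = p.2 := fun p => congrArg (fun q : ℝ × ℝ => q.2) (hHΦ p)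
  -- uniform lower bounds
  have hlow : ∀ k : ℝ → ℝ, Continuous k → (∀ s, k (s + 2 * π) = k s) → (∀ s, 0 < k s) →
      ∃ m > 0, ∀ s, m ≤ k s := by
    intro k hk hkp hk0
    obtain ⟨s₀, -, hs₀⟩ := (isCompact_Icc (a := (0:ℝ)) (b := 2 * π)).exists_isMinOn
      (nonempty_Icc.2 (by positivity)) hk.continuousOn
    refine ⟨k s₀, hk0 s₀, fun s => ?_⟩
    obtain ⟨y, hy, hys⟩ := Function.Periodic.exists_mem_Ico₀ (f := k) (c := 2 * π) hkp
      (by positivity) s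
    rw [hys]
    exact hs₀ (Ico_subset_Icc_self hy)
  obtain ⟨m₁, hm₁, hm₁'⟩ := hlow (fun s => F (s, η)) (hF.continuous.comp (by fun_prop))
    (fun s => hFper s η) (fun s => by have : F (s, 0) < F (s, η) := hmono s hη
                                      rwa [hF0] at this)
  obtain ⟨m₂, hm₂, hm₂'⟩ := hlow (fun s => -F (s, -η)) (hF.continuous.comp (by fun_prop)).neg
    (fun s => by simp [hFper]) (fun s => by
      have : F (s, -η) < F (s, 0) := hmono s (by linarith)
      rw [hF0] at this
      linarith)
  refine ⟨min m₁ m₂, lt_min hm₁ hm₂, H.symm, hHsymm, ?_, H.symm.injective, ?_, ?_, ?_⟩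
  · intro s t
    apply H.injective
    rw [H.apply_symm_apply]
    change _ = Φ _
    have h1 := hfst (s, t)
    have h2 := hsnd (s, t)
    simp only at h1 h2
    simp only [Φ, hFper, Prod.mk.eta]
    rw [h1, h2]
  · intro p
    have h1 : HasFDerivAt H.symm (fderiv ℝ H.symm p) p :=
      (hHsymm.differentiable (by simp) p).hasFDerivAt
    have h2 := (hΦd (H.symm p)).comp p h1
    have h3 : Φ ∘ H.symm = id := funext hHΦ
    rw [h3] at h2
    have h4 := h2.unique (hasFDerivAt_id p)
    have h5 := congrArg ContinuousLinearMap.det h4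
    rw [← hdet]
    rw [ContinuousLinearMap.det, ContinuousLinearMap.toLinearMap_comp, LinearMap.det_comp] at h5
    simpa [ContinuousLinearMap.det] using h5
  · rintro p hp
    obtain ⟨hp1, hp2⟩ := abs_lt.1 hp
    have h1 := hfst p
    have h2 := hsnd p
    have e : H.symm p = (p.1, (H.symm p).2) := by rw [← h1]
    rw [e] at h2
    rw [abs_lt]
    constructor
    · apply (hmono p.1).lt_iff_lt.1
      have := hm₂' p.1
      have := min_le_right m₁ m₂
      linarith
    · apply (hmono p.1).lt_iff_lt.1
      have := hm₁' p.1
      have := min_le_left m₁ m₂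
      linarith
  · intro s
    apply H.injective
    rw [H.apply_symm_apply]
    change _ = Φ _
    simp [Φ, hF0]


/- The cylinder `S¹ × ℝ` is represented by `ℝ × ℝ` with maps that are
`2π`-periodic in the first variable (lifts of cylinder maps). The condition
`f*(dx ∧ dy) = ρ ds ∧ dt` reads `det(df(s,t)) = ρ(s,t)`, and
`(f ∘ θ)*(dx ∧ dy) = ds ∧ dt` reads `det(d(f ∘ θ)(s,t)) = 1`. -/

/-- Moser's normal form near an immersed circle (Lemma `moser`
of the paper). -/
theorem moser_normal_form_near_immersed_circle
    (f : (ℝ × ℝ) → (ℝ × ℝ)) (ρ : (ℝ × ℝ) → ℝ) (ε : ℝ) (hε : 0 < ε)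
    (hf : ContDiff ℝ (⊤ : ℕ∞) f)
    (hfper : ∀ s t, f (s + 2 * π, t) = f (s, t))
    (himm : ∀ p : ℝ × ℝ, |p.2| < ε → Function.Injective (fderiv ℝ f p))
    (hρ : ContDiff ℝ (⊤ : ℕ∞) ρ) (hρpos : ∀ p : ℝ × ℝ, |p.2| < ε → 0 < ρ p)
    (hpull : ∀ p : ℝ × ℝ, |p.2| < ε → (fderiv ℝ f p).det = ρ p) :
    ∃ δ > 0, δ ≤ ε ∧ ∃ θ : (ℝ × ℝ) → (ℝ × ℝ),
      ContDiff ℝ (⊤ : ℕ∞) θ ∧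
      -- `θ` is a lift of a map of the cylinder:
      (∀ s t, θ (s + 2 * π, t) = ((θ (s, t)).1 + 2 * π, (θ (s, t)).2)) ∧
      -- `θ` is a diffeomorphism of `S¹ × (-δ, δ)` onto its image:
      InjOn θ {p : ℝ × ℝ | |p.2| < δ} ∧
      (∀ p : ℝ × ℝ, |p.2| < δ → (fderiv ℝ θ p).det ≠ 0) ∧
      MapsTo θ {p : ℝ × ℝ | |p.2| < δ} {p : ℝ × ℝ | |p.2| < ε} ∧
      -- `θ` fixes the zero section:
      (∀ s, θ (s, 0) = (s, 0)) ∧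
      -- `(f ∘ θ)* (dx ∧ dy) = ds ∧ dt` on `S¹ × (-δ, δ)`:
      (∀ p : ℝ × ℝ, |p.2| < δ → (fderiv ℝ (f ∘ θ) p).det = 1) := by
  have hρper : ∀ s t, |t| < ε → ρ (s + 2 * π, t) = ρ (s, t) := by
    intro s t ht
    rw [← hpull (s + 2 * π, t) ht, ← hpull (s, t) ht]
    have h1 : (fun p : ℝ × ℝ => f (p + (2 * π, 0))) = f := by
      funext ⟨a, b⟩
      simp [hfper]
    have h2 := fderiv_comp_add_right (𝕜 := ℝ) (f := f) (x := (s, t)) (2 * π, (0:ℝ))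
    rw [h1] at h2
    rw [h2]
    simp
  let χ : ContDiffBump (0:ℝ) := ⟨ε / 2, ε, by positivity, by linarith⟩
  have hχ : ContDiff ℝ (⊤ : ℕ∞) χ := χ.contDiff
  have hχ0 : ∀ t : ℝ, ε ≤ |t| → χ t = 0 := fun t ht => χ.zero_of_le_dist (by simpa [χ] using ht)
  have hχ1 : ∀ t : ℝ, |t| < ε / 2 → χ t = 1 := fun t ht =>
    χ.one_of_mem_closedBall (by simpa [χ] using ht.le)
  obtain ⟨δ, hδ, θ, h1, h2, h3, h4, h5, h6⟩ := moser_global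
    (fun p => χ p.2 * ρ p + (1 - χ p.2)) ε hε
    (by
      have := hχ.comp (contDiff_snd (𝕜 := ℝ) (E := ℝ) (F := ℝ))
      exact (this.mul hρ).add (contDiff_const.sub this))
    (by
      intro p
      rcases lt_or_ge |p.2| ε with hp | hp
      · have a := hρpos p hp
        have b : 0 ≤ χ p.2 := χ.nonneg
        have c : χ p.2 ≤ 1 := χ.le_one
        rcases b.eq_or_lt with b | b
        · simp [← b]
        · have := mul_pos b a
          linarith
      · simp [hχ0 _ hp])
    (by
      intro s t
      rcases lt_or_ge |t| ε with hp | hp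
      · simp [hρper s t hp]
      · simp [hχ0 _ hp])
    (by
      intro p hp
      simp [hχ0 _ hp])
    (ε / 2) (by positivity)
  refine ⟨min δ ε, lt_min hδ hε, min_le_right _ _, θ, h1, h2, h3.injOn, ?_, ?_, h6, ?_⟩
  · intro p _ h
    have := h4 p
    rw [h] at this
    simp at this
  · intro p hp
    have := h5 p (lt_of_lt_of_le hp (min_le_left _ _))
    change |(θ p).2| < ε
    linarith
  · intro p hp
    have hθ := h5 p (lt_of_lt_of_le hp (min_le_left _ _))
    have h7 := h4 p
    rw [hχ1 _ hθ, one_mul, sub_self, add_zero] at h7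
    rw [fderiv_comp p (hf.differentiable (by simp) _) (h1.differentiable (by simp) _),
      ContinuousLinearMap.det, ContinuousLinearMap.toLinearMap_comp, LinearMap.det_comp]
    have h8 := hpull (θ p) (by linarith)
    rw [← h8] at h7
    simpa [ContinuousLinearMap.det] using h7
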